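/- arXiv:1011.6204 — 6 statements merged into one kernel-verified Lean document; each statement's English description precedes it below -/
import Mathlib

section
/- For every q ∈ (0,1) and every 1 ≤ i ≤ ℓ+1, the operators Y_{k,q} on H satisfy the sphere relation Y_{i,q} Y_{i,q}* − Y_{i,q}* Y_{i,q} + (1−q²) · Σ_{k=i+1}^{ℓ+1} Y_{k,q} Y_{k,q}* = 0. -/
open scoped BigOperators

noncomputable section

/-- The Hilbert space `H = ℓ²(ℕ^ℓ × ℤ)`. -/
abbrev H (ℓ : ℕ) : Type := lp (fun _ : (Fin ℓ → ℕ) × ℤ => ℂ) 2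

/-- The standard basis vector `e_{(a,z)}` of `H`. -/
noncomputable def basisVec (ℓ : ℕ) (a : Fin ℓ → ℕ) (z : ℤ) : H ℓ :=
  lp.single 2 (a, z) 1

/-- `IsYop ℓ q Y` says that for each `k : Fin (ℓ+1)`, `Y k` is the operator `Y_{k+1,q}`
of the paper (indices shifted so that paper index `i ∈ {1,…,ℓ+1}` is `i-1 : Fin (ℓ+1)`):
for `k ≤ ℓ-1` (paper index `≤ ℓ`),
`Y k e_{(a,z)} = q^{a_0+⋯+a_{k-1}} √(1-q^{2(a_k+1)}) e_{(a+δ_k,z)}`,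
and `Y ℓ e_{(a,z)} = q^{a_0+⋯+a_{ℓ-1}} e_{(a,z+1)}`. -/
def IsYop (ℓ : ℕ) (q : ℝ) (Y : Fin (ℓ + 1) → H ℓ →L[ℂ] H ℓ) : Prop :=
  (∀ (k : Fin ℓ) (a : Fin ℓ → ℕ) (z : ℤ),
      Y k.castSucc (basisVec ℓ a z) =
        (((q ^ (∑ j ∈ Finset.univ.filter (fun j : Fin ℓ => (j : ℕ) < (k : ℕ)), a j) *
            Real.sqrt (1 - q ^ (2 * (a k + 1))) : ℝ) : ℂ)) •
          basisVec ℓ (fun j => if j = k then a j + 1 else a j) z) ∧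
  (∀ (a : Fin ℓ → ℕ) (z : ℤ),
      Y (Fin.last ℓ) (basisVec ℓ a z) =
        (((q ^ (∑ j, a j) : ℝ) : ℂ)) • basisVec ℓ a (z + 1))

theorem inner_basisVec_left (ℓ : ℕ) (p : (Fin ℓ → ℕ) × ℤ) (x : H ℓ) :
    inner ℂ (basisVec ℓ p.1 p.2) x = x p := by
  simp [basisVec, lp.inner_single_left]

theorem inner_basisVec_basisVec (ℓ : ℕ) (p r : (Fin ℓ → ℕ) × ℤ) :
    inner ℂ (basisVec ℓ p.1 p.2) (basisVec ℓ r.1 r.2) = if p = r then 1 else 0 := by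
  rw [inner_basisVec_left, basisVec, lp.coeFn_single, Pi.single_apply]

theorem clm_ext_basisVec {ℓ : ℕ} {S T : H ℓ →L[ℂ] H ℓ}
    (h : ∀ a z, S (basisVec ℓ a z) = T (basisVec ℓ a z)) : S = T := by
  refine lp.ext_continuousLinearMap (by simp) fun p ↦ ?_
  ext
  simpa [basisVec] using congrArg (fun x : H ℓ ↦ x _) (h p.1 p.2)

open ContinuousLinearMap in
/-- The adjoint of a weighted injective shift with real weights. -/
theorem adjoint_weightedShift {ℓ : ℕ} {T : H ℓ →L[ℂ] H ℓ} {w : (Fin ℓ → ℕ) × ℤ → ℝ}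
    {σ : (Fin ℓ → ℕ) × ℤ → (Fin ℓ → ℕ) × ℤ}
    (hT : ∀ p, T (basisVec ℓ p.1 p.2) = (w p : ℂ) • basisVec ℓ (σ p).1 (σ p).2)
    (hσ : σ.Injective) (p : (Fin ℓ → ℕ) × ℤ) :
    adjoint T (basisVec ℓ (σ p).1 (σ p).2) = (w p : ℂ) • basisVec ℓ p.1 p.2 := by
  ext r
  rw [← inner_basisVec_left, ← inner_basisVec_left, adjoint_inner_right, hT, inner_smul_left,
    inner_smul_right, inner_basisVec_basisVec, inner_basisVec_basisVec, Complex.conj_ofReal]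
  simp only [hσ.eq_iff]
  split_ifs with h <;> simp [h]

open ContinuousLinearMap in
theorem adjoint_weightedShift_of_notMem_range {ℓ : ℕ} {T : H ℓ →L[ℂ] H ℓ}
    {w : (Fin ℓ → ℕ) × ℤ → ℝ} {σ : (Fin ℓ → ℕ) × ℤ → (Fin ℓ → ℕ) × ℤ}
    (hT : ∀ p, T (basisVec ℓ p.1 p.2) = (w p : ℂ) • basisVec ℓ (σ p).1 (σ p).2)
    {b : (Fin ℓ → ℕ) × ℤ} (hb : b ∉ Set.range σ) :
    adjoint T (basisVec ℓ b.1 b.2) = 0 := by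
  ext r
  rw [← inner_basisVec_left, adjoint_inner_right, hT, inner_smul_left, inner_basisVec_basisVec,
    if_neg fun h ↦ hb ⟨r, h⟩]
  simp

/-- The eigenvalue `q^{2(a_0+⋯+a_{n-1})}` for `n ≤ ℓ`, extended by `0` for `n > ℓ`. -/
def partialWeight (ℓ : ℕ) (q : ℝ) (a : Fin ℓ → ℕ) (n : ℕ) : ℝ :=
  if n ≤ ℓ then (q ^ ∑ j ∈ Finset.univ.filter (fun j : Fin ℓ => (j : ℕ) < n), a j) ^ 2 else 0

theorem partialWeight_succ {ℓ : ℕ} (q : ℝ) (a : Fin ℓ → ℕ) (k : Fin ℓ) :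
    partialWeight ℓ q a (k + 1) = partialWeight ℓ q a k * q ^ (2 * a k) := by
  have hfilter : Finset.univ.filter (fun j : Fin ℓ => (j : ℕ) < k + 1) =
      insert k (Finset.univ.filter (fun j : Fin ℓ => (j : ℕ) < k)) := by
    ext j
    simp [Fin.ext_iff]
    omega
  rw [partialWeight, partialWeight, if_pos (Nat.succ_le_of_lt k.isLt), if_pos k.isLt.le, hfilter,
    Finset.sum_insert (by simp)]
  ring

theorem partialWeight_self (ℓ : ℕ) (q : ℝ) (a : Fin ℓ → ℕ) :
    partialWeight ℓ q a ℓ = (q ^ ∑ j, a j) ^ 2 := by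
  simp [partialWeight]

theorem partialWeight_of_lt {ℓ n : ℕ} (h : ℓ < n) (q : ℝ) (a : Fin ℓ → ℕ) :
    partialWeight ℓ q a n = 0 :=
  if_neg h.not_ge

theorem sum_sub_succ_filter_lt {ℓ : ℕ} (f : ℕ → ℝ) (i : Fin (ℓ + 1)) :
    ∑ k ∈ Finset.univ.filter (fun k : Fin (ℓ + 1) => i < k), (f k - f (k + 1)) =
      f (i + 1) - f (ℓ + 1) := by
  obtain ⟨i, hi⟩ := i
  rw [Finset.sum_filter]
  simp only [Fin.lt_def]
  rw [Fin.sum_univ_eq_sum_range (fun n ↦ if i < n then f n - f (n + 1) else 0)]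
  induction ℓ with
  | zero =>
    obtain rfl : i = 0 := by omega
    simp
  | succ ℓ ih =>
    rw [Finset.sum_range_succ]
    rcases Nat.lt_succ_iff_lt_or_eq.mp hi with h | rfl
    · rw [ih h, if_pos h]
      ring
    · rw [Finset.sum_eq_zero, if_neg (lt_irrefl _)]
      · simp
      · intro n hn
        exact if_neg (by simp at hn; omega)

/-- The shift of basis indices performed by the `k`-th operator, for `k < ℓ`. -/
def raise {ℓ : ℕ} (k : Fin ℓ) (p : (Fin ℓ → ℕ) × ℤ) : (Fin ℓ → ℕ) × ℤ :=
  (fun j => if j = k then p.1 j + 1 else p.1 j, p.2)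

theorem raise_injective {ℓ : ℕ} (k : Fin ℓ) : (raise k).Injective := by
  rintro ⟨a, z⟩ ⟨b, y⟩ h
  obtain ⟨h₁, h₂⟩ := Prod.ext_iff.mp h
  refine Prod.ext (funext fun j ↦ ?_) h₂
  have := congrFun h₁ j
  simp only [raise] at this ⊢
  split_ifs at this <;> omega

theorem mem_range_raise {ℓ : ℕ} {k : Fin ℓ} {b : (Fin ℓ → ℕ) × ℤ} (hb : b.1 k ≠ 0) :
    b ∈ Set.range (raise k) := by
  refine ⟨(fun j => if j = k then b.1 j - 1 else b.1 j, b.2), Prod.ext (funext fun j ↦ ?_) rfl⟩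
  simp only [raise]
  split_ifs with h
  · subst h
    omega
  · rfl

theorem partialWeight_raise {ℓ : ℕ} (q : ℝ) (k : Fin ℓ) (p : (Fin ℓ → ℕ) × ℤ) :
    partialWeight ℓ q (raise k p).1 k = partialWeight ℓ q p.1 k := by
  rw [partialWeight, partialWeight]
  congr 3
  refine Finset.sum_congr rfl fun j hj ↦ if_neg ?_
  rintro rfl
  simp at hj

theorem sq_weight {ℓ : ℕ} {q : ℝ} (hq : q ∈ Set.Ioo (0 : ℝ) 1) (k : Fin ℓ) (a : Fin ℓ → ℕ) :
    (q ^ (∑ j ∈ Finset.univ.filter (fun j : Fin ℓ => (j : ℕ) < (k : ℕ)), a j) *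
      Real.sqrt (1 - q ^ (2 * (a k + 1)))) ^ 2 =
      partialWeight ℓ q a k - q ^ 2 * partialWeight ℓ q a (k + 1) := by
  rw [mul_pow, Real.sq_sqrt (sub_nonneg.mpr (pow_le_one₀ hq.1.le hq.2.le)), partialWeight_succ,
    partialWeight, if_pos k.isLt.le]
  ring

theorem apply_castSucc_basisVec {ℓ : ℕ} {q : ℝ} {Y : Fin (ℓ + 1) → H ℓ →L[ℂ] H ℓ}
    (hY : IsYop ℓ q Y) (k : Fin ℓ) (p : (Fin ℓ → ℕ) × ℤ) :
    Y k.castSucc (basisVec ℓ p.1 p.2) =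
      (((q ^ (∑ j ∈ Finset.univ.filter (fun j : Fin ℓ => (j : ℕ) < (k : ℕ)), p.1 j) *
          Real.sqrt (1 - q ^ (2 * (p.1 k + 1))) : ℝ) : ℂ)) •
        basisVec ℓ (raise k p).1 (raise k p).2 :=
  hY.1 k p.1 p.2

open ContinuousLinearMap in
theorem adjoint_comp_self_basisVec {ℓ : ℕ} {q : ℝ} (hq : q ∈ Set.Ioo (0 : ℝ) 1)
    {Y : Fin (ℓ + 1) → H ℓ →L[ℂ] H ℓ} (hY : IsYop ℓ q Y) (k : Fin (ℓ + 1))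
    (p : (Fin ℓ → ℕ) × ℤ) :
    adjoint (Y k) (Y k (basisVec ℓ p.1 p.2)) =
      ((partialWeight ℓ q p.1 k - q ^ 2 * partialWeight ℓ q p.1 (k + 1) : ℝ) : ℂ) •
        basisVec ℓ p.1 p.2 := by
  induction k using Fin.lastCases with
  | last =>
    have hT (p : (Fin ℓ → ℕ) × ℤ) := hY.2 p.1 p.2
    have hσ : (fun p : (Fin ℓ → ℕ) × ℤ ↦ (p.1, p.2 + 1)).Injective := by
      rintro ⟨a, z⟩ ⟨b, y⟩ h
      simpa using h
    rw [hT, map_smul, adjoint_weightedShift hT hσ, smul_smul, Fin.val_last, partialWeight_self,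
      partialWeight_of_lt ℓ.lt_succ_self, mul_zero, sub_zero, ← Complex.ofReal_mul, ← sq]
  | cast k =>
    have hT := apply_castSucc_basisVec hY k
    rw [hT, map_smul, adjoint_weightedShift hT (raise_injective k), smul_smul,
      ← Complex.ofReal_mul, ← sq, sq_weight hq, Fin.val_castSucc]

open ContinuousLinearMap in
theorem self_comp_adjoint_basisVec {ℓ : ℕ} {q : ℝ} (hq : q ∈ Set.Ioo (0 : ℝ) 1)
    {Y : Fin (ℓ + 1) → H ℓ →L[ℂ] H ℓ} (hY : IsYop ℓ q Y) (k : Fin (ℓ + 1))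
    (b : (Fin ℓ → ℕ) × ℤ) :
    Y k (adjoint (Y k) (basisVec ℓ b.1 b.2)) =
      ((partialWeight ℓ q b.1 k - partialWeight ℓ q b.1 (k + 1) : ℝ) : ℂ) •
        basisVec ℓ b.1 b.2 := by
  induction k using Fin.lastCases with
  | last =>
    have hT (p : (Fin ℓ → ℕ) × ℤ) := hY.2 p.1 p.2
    have hσ : (fun p : (Fin ℓ → ℕ) × ℤ ↦ (p.1, p.2 + 1)).Injective := by
      rintro ⟨a, z⟩ ⟨b, y⟩ h
      simpa using h
    obtain ⟨p, rfl⟩ : b ∈ Set.range fun p : (Fin ℓ → ℕ) × ℤ ↦ (p.1, p.2 + 1) :=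
      ⟨(b.1, b.2 - 1), by simp⟩
    rw [adjoint_weightedShift hT hσ, map_smul, hT, smul_smul, Fin.val_last, partialWeight_self,
      partialWeight_of_lt ℓ.lt_succ_self, sub_zero, ← Complex.ofReal_mul, ← sq]
  | cast k =>
    have hT := apply_castSucc_basisVec hY k
    by_cases hb : b ∈ Set.range (raise k)
    · obtain ⟨p, rfl⟩ := hb
      have hk : (raise k p).1 k = p.1 k + 1 := if_pos rfl
      rw [adjoint_weightedShift hT (raise_injective k), map_smul, hT, smul_smul,
        ← Complex.ofReal_mul, ← sq, sq_weight hq, Fin.val_castSucc, partialWeight_succ,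
        partialWeight_succ, partialWeight_raise, hk]
      congr 2
      ring
    · have hk : b.1 k = 0 := by
        by_contra h
        exact hb (mem_range_raise h)
      rw [adjoint_weightedShift_of_notMem_range hT hb, map_zero,
        Fin.val_castSucc, partialWeight_succ, hk]
      simp

open ContinuousLinearMap in
/-- The sphere relation
`Y_i Y_i* − Y_i* Y_i + (1−q²) ∑_{k>i} Y_k Y_k* = 0` for every `i` and `q ∈ (0,1)`. -/
theorem Y_sphere_relation (ℓ : ℕ) (hℓ : 1 ≤ ℓ) (q : ℝ) (hq : q ∈ Set.Ioo (0 : ℝ) 1)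
    (Y : Fin (ℓ + 1) → H ℓ →L[ℂ] H ℓ) (hY : IsYop ℓ q Y) (i : Fin (ℓ + 1)) :
    Y i ∘L adjoint (Y i) - adjoint (Y i) ∘L Y i +
      ((1 - q ^ 2 : ℝ) : ℂ) •
        ∑ k ∈ Finset.univ.filter (fun k : Fin (ℓ + 1) => i < k), Y k ∘L adjoint (Y k) = 0 := by
  refine clm_ext_basisVec fun a z ↦ ?_
  have hsum := sum_sub_succ_filter_lt (partialWeight ℓ q a) i
  rw [partialWeight_of_lt ℓ.lt_succ_self, sub_zero] at hsum
  simp only [add_apply, sub_apply, comp_apply, smul_apply, sum_apply, zero_apply,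
    self_comp_adjoint_basisVec hq hY _ (a, z), adjoint_comp_self_basisVec hq hY _ (a, z)]
  rw [← Finset.sum_smul, ← Complex.ofReal_sum, hsum, smul_smul, ← sub_smul, ← add_smul]
  convert zero_smul ℂ (basisVec ℓ a z)
  push_cast
  ring
end
end

section
/- For 1 ≤ i < j ≤ ℓ+1, r, r′ ∈ ℤ and m, n, m′, n′ ∈ ℕ^ℓ: if (n_1,…,n_{i−1}) = (m′_1,…,m′_{i−1}) and m′_i ≥ n_i then B_i(r,m,n) B_j(r′,m′,n′) = B_j(r′, m″, n′), where m″ = (m_1,…,m_{i−1}, m_i + m′_i − n_i, m′_{i+1},…,m′_ℓ); otherwise B_i(r,m,n) B_j(r′,m′,n′) = 0. -/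
open scoped BigOperators

noncomputable section

/-- `IsBop ℓ B` says that for each `i : Fin (ℓ+1)`, `r : ℤ` and `m n : Fin ℓ → ℕ`,
`B i r m n` is the operator `B_{i+1}(r,m,n)` of the paper (paper index `i ∈ {1,…,ℓ+1}`
is `i-1 : Fin (ℓ+1)` here).  For `k : Fin ℓ` (paper index `k+1 ≤ ℓ`) :
`B k r m n e_{(a,z)} = e_{(a',z+Σ_{j≤k}(m_j−n_j))}` if `a_j = n_j` for `j < k` and
`a_k ≥ n_k` (where `a'_j = m_j` for `j < k`, `a'_k = a_k − n_k + m_k`, `a'_j = a_j`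
for `j > k`), and `= 0` otherwise; and
`B ℓ r m n e_{(a,z)} = e_{(m, z + r + Σ_j (m_j − n_j))}` if `a = n`, and `= 0` otherwise. -/
def IsBop (ℓ : ℕ)
    (B : Fin (ℓ + 1) → ℤ → (Fin ℓ → ℕ) → (Fin ℓ → ℕ) → (H ℓ →L[ℂ] H ℓ)) : Prop :=
  (∀ (k : Fin ℓ) (r : ℤ) (m n : Fin ℓ → ℕ) (a : Fin ℓ → ℕ) (z : ℤ),
      B k.castSucc r m n (basisVec ℓ a z) =
        if (∀ j : Fin ℓ, j < k → a j = n j) ∧ n k ≤ a k then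
          basisVec ℓ
            (fun j => if j < k then m j else if j = k then a k - n k + m k else a j)
            (z + ∑ j ∈ Finset.univ.filter (fun j : Fin ℓ => j ≤ k), ((m j : ℤ) - (n j : ℤ)))
        else 0) ∧
  (∀ (r : ℤ) (m n : Fin ℓ → ℕ) (a : Fin ℓ → ℕ) (z : ℤ),
      B (Fin.last ℓ) r m n (basisVec ℓ a z) =
        if a = n then basisVec ℓ m (z + r + ∑ j, ((m j : ℤ) - (n j : ℤ))) else 0)

theorem sum_sub_add_sum_sub {ℓ : ℕ} (i : Fin ℓ) (S : Finset (Fin ℓ)) (hS : ∀ t ≤ i, t ∈ S)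
    (m n m' n' : Fin ℓ → ℕ) (hlt : ∀ t < i, n t = m' t) (hle : n i ≤ m' i) :
    ∑ t ∈ S, ((m' t : ℤ) - n' t)
        + ∑ t ∈ Finset.univ.filter (fun t : Fin ℓ => t ≤ i), ((m t : ℤ) - n t) =
      ∑ t ∈ S, (((if t < i then m t else if t = i then m i + m' i - n i else m' t : ℕ) : ℤ)
        - n' t) := by
  have hfilter : Finset.univ.filter (fun t : Fin ℓ => t ≤ i) = S.filter (fun t => t ≤ i) := by
    ext t
    simpa using hS t
  rw [hfilter, Finset.sum_filter, ← Finset.sum_add_distrib]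
  refine Finset.sum_congr rfl fun t _ => ?_
  rcases lt_trichotomy t i with h | rfl | h
  · have := hlt t h
    simp only [h, h.le, if_true]
    omega
  · simp only [le_refl, lt_irrefl, if_true, if_false]
    omega
  · simp [h.not_ge, h.not_gt, h.ne']

/-- For `i < j` (paper indices `1 ≤ i < j ≤ ℓ+1`):
if `(n_1,…,n_{i−1}) = (m′_1,…,m′_{i−1})` and `m′_i ≥ n_i` then
`B_i(r,m,n) B_j(r′,m′,n′) = B_j(r′,m″,n′)` where
`m″ = (m_1,…,m_{i−1}, m_i + m′_i − n_i, m′_{i+1},…,m′_ℓ)`; otherwise the product is `0`. -/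
theorem B_mul_of_lt (ℓ : ℕ) (hℓ : 1 ≤ ℓ)
    (B : Fin (ℓ + 1) → ℤ → (Fin ℓ → ℕ) → (Fin ℓ → ℕ) → (H ℓ →L[ℂ] H ℓ))
    (hB : IsBop ℓ B) (i : Fin ℓ) (j : Fin (ℓ + 1)) (hij : i.castSucc < j)
    (r r' : ℤ) (m n m' n' : Fin ℓ → ℕ) :
    B i.castSucc r m n ∘L B j r' m' n' =
      if (∀ t : Fin ℓ, t < i → n t = m' t) ∧ n i ≤ m' i then
        B j r' (fun t => if t < i then m t else if t = i then m i + m' i - n i else m' t) n'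
      else 0 := by
  obtain ⟨hlow, hlast⟩ := hB
  refine clm_ext_basisVec fun a z => ?_
  rw [ContinuousLinearMap.comp_apply]
  induction j using Fin.lastCases with
  | last =>
    rw [hlast]
    by_cases ha : a = n'
    · rw [if_pos ha, hlow]
      by_cases hc : (∀ t : Fin ℓ, t < i → n t = m' t) ∧ n i ≤ m' i
      · have hc' : (∀ t : Fin ℓ, t < i → m' t = n t) ∧ n i ≤ m' i :=
          ⟨fun t ht => (hc.1 t ht).symm, hc.2⟩
        rw [if_pos hc, if_pos hc', hlast, if_pos ha,
          ← sum_sub_add_sum_sub i Finset.univ (by simp) m n m' n' hc.1 hc.2]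
        congr 1
        · funext t
          have := hc.2
          split_ifs <;> omega
        · ring
      · rw [if_neg hc, if_neg fun h => hc ⟨fun t ht => (h.1 t ht).symm, h.2⟩]
        rfl
    · rw [if_neg ha, map_zero]
      split_ifs
      · rw [hlast, if_neg ha]
      · rfl
  | cast k =>
    have hik : i < k := by simpa using hij
    rw [hlow]
    by_cases ha : (∀ t : Fin ℓ, t < k → a t = n' t) ∧ n' k ≤ a k
    · rw [if_pos ha, hlow]
      by_cases hc : (∀ t : Fin ℓ, t < i → n t = m' t) ∧ n i ≤ m' i
      · rw [if_pos hc, if_pos ⟨fun t ht => by simp [ht.trans hik, hc.1 t ht], by simp [hik, hc.2]⟩,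
          hlow, if_pos ha,
          ← sum_sub_add_sum_sub i _ (fun t ht => by simp [ht.trans hik.le]) m n m' n' hc.1 hc.2]
        congr 1
        · funext t
          have := hc.2
          rcases lt_trichotomy t i with h | rfl | h
          · simp [h, h.trans hik]
          · simp only [lt_irrefl, if_true, if_false, hik]
            omega
          · simp [h.not_gt, h.ne', hik.not_gt, hik.ne']
        · ring
      · rw [if_neg hc, if_neg]
        · rfl
        · rintro ⟨h₁, h₂⟩
          refine hc ⟨fun t ht => ?_, by simpa [hik] using h₂⟩
          simpa [ht.trans hik] using (h₁ t ht).symm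
    · rw [if_neg ha, map_zero]
      split_ifs
      · rw [hlow, if_neg ha]
      · rfl
end
end

section
/- For 1 ≤ i ≤ ℓ, r, r′ ∈ ℤ and m, n, m′, n′ ∈ ℕ^ℓ with n_i ≤ m′_i: if (n_1,…,n_{i−1}) = (m′_1,…,m′_{i−1}) then B_i(r,m,n) B_i(r′,m′,n′) = B_i(r′, m″, n′), where m″ = (m_1,…,m_{i−1}, m_i + m′_i − n_i, m′_{i+1},…,m′_ℓ); otherwise B_i(r,m,n) B_i(r′,m′,n′) = 0. -/
open scoped BigOperators

noncomputable section

/-- Continuous linear maps out of `H ℓ` are determined by their values on the standard basis. -/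
theorem H.clm_ext {ℓ : ℕ} {F : Type*} [NormedAddCommGroup F] [NormedSpace ℂ F]
    {S T : H ℓ →L[ℂ] F} (h : ∀ a z, S (basisVec ℓ a z) = T (basisVec ℓ a z)) : S = T := by
  refine lp.ext_continuousLinearMap (by norm_num) fun ⟨a, z⟩ => ?_
  ext
  simpa [basisVec] using h a z

/-- For `i ≤ ℓ` and `n_i ≤ m′_i`: if `(n_1,…,n_{i−1}) = (m′_1,…,m′_{i−1})` then
`B_i(r,m,n) B_i(r′,m′,n′) = B_i(r′,m″,n′)` where
`m″ = (m_1,…,m_{i−1}, m_i + m′_i − n_i, m′_{i+1},…,m′_ℓ)`; otherwise the product is `0`. -/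
theorem B_mul_same_le (ℓ : ℕ) (hℓ : 1 ≤ ℓ)
    (B : Fin (ℓ + 1) → ℤ → (Fin ℓ → ℕ) → (Fin ℓ → ℕ) → (H ℓ →L[ℂ] H ℓ))
    (hB : IsBop ℓ B) (i : Fin ℓ) (r r' : ℤ) (m n m' n' : Fin ℓ → ℕ)
    (hle : n i ≤ m' i) :
    B i.castSucc r m n ∘L B i.castSucc r' m' n' =
      if ∀ t : Fin ℓ, t < i → n t = m' t then
        B i.castSucc r'
          (fun t => if t < i then m t else if t = i then m i + m' i - n i else m' t) n'
      else 0 := by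
  refine H.clm_ext fun a z => ?_
  rw [ContinuousLinearMap.comp_apply, hB.1]
  by_cases ha : (∀ j : Fin ℓ, j < i → a j = n' j) ∧ n' i ≤ a i
  · rw [if_pos ha, hB.1]
    by_cases hnm : ∀ t : Fin ℓ, t < i → n t = m' t
    · rw [if_pos hnm, hB.1, if_pos ha, if_pos]
      · congr 1
        · funext j
          obtain ⟨-, ha⟩ := ha
          split_ifs <;> simp_all
          omega
        · rw [add_assoc, ← Finset.sum_add_distrib]
          congr 1
          refine Finset.sum_congr rfl fun j hj => ?_
          rcases (Finset.mem_filter.mp hj).2.lt_or_eq with hlt | rfl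
          · simp [hlt, hnm j hlt]
          · simp only [lt_irrefl, if_false, if_true]
            omega
      · refine ⟨fun j hj => by simp [hj, hnm j hj], ?_⟩
        simp only [lt_irrefl, if_false, if_true]
        omega
    · rw [if_neg hnm, if_neg, zero_apply]
      rintro ⟨hj, -⟩
      exact hnm fun t ht => by simpa [ht] using (hj t ht).symm
  · rw [if_neg ha, map_zero]
    split_ifs
    · rw [hB.1, if_neg ha]
    · rfl
end
end

section
/- For 1 ≤ i ≤ ℓ, r, r′ ∈ ℤ and m, n, m′, n′ ∈ ℕ^ℓ with n_i ≥ m′_i: if (n_1,…,n_{i−1}) = (m′_1,…,m′_{i−1}) then B_i(r,m,n) B_i(r′,m′,n′) = B_i(r, m, n″), where n″ = (n′_1,…,n′_{i−1}, n′_i + n_i − m′_i, n′_{i+1},…,n′_ℓ); otherwise B_i(r,m,n) B_i(r′,m′,n′) = 0. -/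
open scoped BigOperators

noncomputable section

/-- For `i ≤ ℓ` and `n_i ≥ m′_i`: if `(n_1,…,n_{i−1}) = (m′_1,…,m′_{i−1})` then
`B_i(r,m,n) B_i(r′,m′,n′) = B_i(r,m,n″)` where
`n″ = (n′_1,…,n′_{i−1}, n′_i + n_i − m′_i, n′_{i+1},…,n′_ℓ)`; otherwise the product is `0`. -/
theorem B_mul_same_ge (ℓ : ℕ) (hℓ : 1 ≤ ℓ)
    (B : Fin (ℓ + 1) → ℤ → (Fin ℓ → ℕ) → (Fin ℓ → ℕ) → (H ℓ →L[ℂ] H ℓ))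
    (hB : IsBop ℓ B) (i : Fin ℓ) (r r' : ℤ) (m n m' n' : Fin ℓ → ℕ)
    (hge : m' i ≤ n i) :
    B i.castSucc r m n ∘L B i.castSucc r' m' n' =
      if ∀ t : Fin ℓ, t < i → n t = m' t then
        B i.castSucc r m
          (fun t => if t = i then n' i + n i - m' i else n' t)
      else 0 := by
  obtain ⟨hB, -⟩ := hB
  refine clm_ext_basisVec fun a z => ?_
  rw [ContinuousLinearMap.comp_apply, hB]
  by_cases hnm : ∀ t : Fin ℓ, t < i → n t = m' t
  · rw [if_pos hnm, hB]
    by_cases ha : (∀ j : Fin ℓ, j < i → a j = n' j) ∧ n' i ≤ a i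
    · rw [if_pos ha, hB]
      have hlt : ∀ j : Fin ℓ, j < i → m' j = n j := fun j hj => (hnm j hj).symm
      have hne : ∀ j : Fin ℓ, j < i → a j = if j = i then n' i + n i - m' i else n' j :=
        fun j hj => by rw [if_neg hj.ne, ha.1 j hj]
      by_cases hi : n' i + n i - m' i ≤ a i
      · have hsub : n i ≤ a i - n' i + m' i := by omega
        refine (if_pos ⟨fun j hj => by simp [hj, hlt j hj], by simpa using hsub⟩).trans
          ((congrArg₂ (basisVec ℓ) ?_ ?_).trans (if_pos ⟨hne, by simpa using hi⟩).symm)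
        · funext j
          by_cases hj : j < i
          · simp [hj]
          · by_cases hji : j = i
            · subst hji
              simp only [lt_irrefl, if_true, if_false]
              omega
            · simp [hj, hji]
        · rw [add_assoc, ← Finset.sum_add_distrib]
          congr 1
          refine Finset.sum_congr rfl fun j hj => ?_
          rcases (Finset.mem_filter.mp hj).2.lt_or_eq with hj | rfl
          · rw [if_neg hj.ne, hnm j hj]
            ring
          · rw [if_pos rfl]
            omega
      · refine (if_neg ?_).trans (if_neg ?_).symm
        · rintro ⟨-, h⟩
          simp only [lt_irrefl, if_true, if_false] at h
          omega
        · rintro ⟨-, h⟩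
          exact hi (by simpa using h)
    · rw [if_neg ha, map_zero, if_neg]
      rintro ⟨h, h'⟩
      refine ha ⟨fun j hj => by simpa [hj.ne] using h j hj, ?_⟩
      simp only [if_true] at h'
      omega
  · rw [if_neg hnm, zero_apply]
    split_ifs with ha
    · rw [hB, if_neg]
      rintro ⟨h, -⟩
      exact hnm fun t ht => by simpa [ht] using (h t ht).symm
    · exact map_zero _
end
end

section
/- The set T := {0} ∪ {B_i(r,m,n) : 1 ≤ i ≤ ℓ+1, r ∈ ℤ, m,n ∈ ℕ^ℓ} of bounded operators on H is an inverse semigroup of partial isometries: T is closed under operator multiplication and under adjoints, and for every s ∈ T the element s* is the unique element t ∈ T satisfying s t s = s and t s t = t. -/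
open scoped BigOperators

noncomputable section

/-- The set `T = {0} ∪ {B_i(r,m,n)}` of bounded operators on `H`. -/
def Tset (ℓ : ℕ)
    (B : Fin (ℓ + 1) → ℤ → (Fin ℓ → ℕ) → (Fin ℓ → ℕ) → (H ℓ →L[ℂ] H ℓ)) :
    Set (H ℓ →L[ℂ] H ℓ) :=
  {0} ∪ {x | ∃ (i : Fin (ℓ + 1)) (r : ℤ) (m n : Fin ℓ → ℕ), x = B i r m n}

section PartialPermutation

open ContinuousLinearMap

variable {ι E : Type*} [NormedAddCommGroup E] [InnerProductSpace ℂ E]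

/-- The operator `s` maps each vector of the Hilbert basis `b` to zero or to a vector of `b`, and
does so injectively where it is non-zero. -/
def IsPartialPerm (b : HilbertBasis ι ℂ E) (s : E →L[ℂ] E) : Prop :=
  (∀ i, s (b i) = 0 ∨ ∃ j, s (b i) = b j) ∧
    ∀ i i' j, s (b i) = b j → s (b i') = b j → i = i'

variable {b : HilbertBasis ι ℂ E} {s t : E →L[ℂ] E}

theorem HilbertBasis.apply_ne_zero (b : HilbertBasis ι ℂ E) (i : ι) : b i ≠ 0 :=
  b.orthonormal.ne_zero i

theorem HilbertBasis.injective (b : HilbertBasis ι ℂ E) : Function.Injective b :=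
  b.orthonormal.linearIndependent.injective

theorem HilbertBasis.ext_inner (b : HilbertBasis ι ℂ E) {x y : E}
    (h : ∀ i, inner ℂ (b i) x = inner ℂ (b i) y) : x = y := by
  apply b.repr.injective
  ext i
  simpa only [b.repr_apply_apply] using h i

theorem HilbertBasis.ext_continuousLinearMap (b : HilbertBasis ι ℂ E)
    (h : ∀ i, s (b i) = t (b i)) : s = t := by
  refine ContinuousLinearMap.ext_on (s := Set.range b) ?_ ?_
  · rw [Submodule.dense_iff_topologicalClosure_eq_top]
    exact b.dense_span
  · rintro _ ⟨i, rfl⟩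
    exact h i

namespace IsPartialPerm

theorem zero (b : HilbertBasis ι ℂ E) : IsPartialPerm b 0 :=
  ⟨fun _ => Or.inl rfl, fun _ _ j h => (b.apply_ne_zero j h.symm).elim⟩

theorem ext_iff (hs : IsPartialPerm b s) (ht : IsPartialPerm b t)
    (h : ∀ i j, s (b i) = b j ↔ t (b i) = b j) : s = t := by
  refine b.ext_continuousLinearMap fun i => ?_
  rcases hs.1 i with hi | ⟨j, hj⟩
  · rcases ht.1 i with hi' | ⟨j, hj⟩
    · rw [hi, hi']
    · rw [hj, (h i j).2 hj]
  · rw [hj, (h i j).1 hj]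

theorem eq_zero (hs : IsPartialPerm b s) (h : ∀ i j, s (b i) ≠ b j) : s = 0 :=
  hs.ext_iff (zero b) fun i j =>
    ⟨fun h' => (h i j h').elim, fun h' => (b.apply_ne_zero j h'.symm).elim⟩

theorem comp_apply_iff (ht : IsPartialPerm b t) {i j : ι} :
    (s ∘L t) (b i) = b j ↔ ∃ k, t (b i) = b k ∧ s (b k) = b j := by
  constructor
  · intro h
    rw [comp_apply] at h
    rcases ht.1 i with hi | ⟨k, hk⟩
    · rw [hi, map_zero] at h
      exact (b.apply_ne_zero j h.symm).elim
    · exact ⟨k, hk, hk ▸ h⟩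
  · rintro ⟨k, hk, h⟩
    rw [comp_apply, hk, h]

protected theorem comp (hs : IsPartialPerm b s) (ht : IsPartialPerm b t) :
    IsPartialPerm b (s ∘L t) := by
  refine ⟨fun i => ?_, fun i i' j h h' => ?_⟩
  · rw [comp_apply]
    rcases ht.1 i with hi | ⟨k, hk⟩
    · exact Or.inl (by rw [hi, map_zero])
    · rw [hk]
      exact hs.1 k
  · obtain ⟨k, hk, h⟩ := ht.comp_apply_iff.1 h
    obtain ⟨k', hk', h'⟩ := ht.comp_apply_iff.1 h'
    obtain rfl := hs.2 _ _ _ h h'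
    exact ht.2 _ _ _ hk hk'

theorem apply_of_comp_comp_eq (hs : IsPartialPerm b s) (ht : IsPartialPerm b t)
    (h : s ∘L t ∘L s = s) {i j : ι} (hij : s (b i) = b j) : t (b j) = b i := by
  have h1 : s (t (b j)) = b j := by
    rw [← hij]
    exact DFunLike.congr_fun h (b i)
  rcases ht.1 j with hj | ⟨k, hk⟩
  · rw [hj, map_zero] at h1
    exact (b.apply_ne_zero j h1.symm).elim
  · rw [hk] at h1
    rw [hk, hs.2 _ _ _ h1 hij]

variable [CompleteSpace E]

theorem adjoint_apply_of_apply (hs : IsPartialPerm b s) {i j : ι} (h : s (b i) = b j) :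
    adjoint s (b j) = b i := by
  classical
  refine b.ext_inner fun k => ?_
  rw [adjoint_inner_right, orthonormal_iff_ite.1 b.orthonormal k i]
  rcases hs.1 k with hk | ⟨l, hl⟩
  · rw [if_neg, hk, inner_zero_left]
    rintro rfl
    exact b.apply_ne_zero j (h.symm.trans hk)
  · rw [hl, orthonormal_iff_ite.1 b.orthonormal l j]
    refine if_congr ⟨?_, ?_⟩ rfl rfl
    · rintro rfl
      exact hs.2 _ _ _ hl h
    · rintro rfl
      exact b.injective (hl.symm.trans h)

theorem adjoint_apply_of_forall_ne (hs : IsPartialPerm b s) {j : ι} (h : ∀ i, s (b i) ≠ b j) :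
    adjoint s (b j) = 0 := by
  classical
  refine b.ext_inner fun k => ?_
  rw [adjoint_inner_right, inner_zero_right]
  rcases hs.1 k with hk | ⟨l, hl⟩
  · rw [hk, inner_zero_left]
  · rw [hl, orthonormal_iff_ite.1 b.orthonormal l j, if_neg]
    rintro rfl
    exact h k hl

theorem adjoint_apply_iff (hs : IsPartialPerm b s) {i j : ι} :
    adjoint s (b j) = b i ↔ s (b i) = b j := by
  refine ⟨fun h => ?_, hs.adjoint_apply_of_apply⟩
  by_cases h' : ∃ k, s (b k) = b j
  · obtain ⟨k, hk⟩ := h'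
    rwa [← b.injective ((hs.adjoint_apply_of_apply hk).symm.trans h)]
  · push Not at h'
    exact (b.apply_ne_zero i (h.symm.trans (hs.adjoint_apply_of_forall_ne h'))).elim

protected theorem adjoint (hs : IsPartialPerm b s) : IsPartialPerm b (adjoint s) := by
  refine ⟨fun j => ?_, fun j j' i h h' => ?_⟩
  · by_cases h : ∃ i, s (b i) = b j
    · exact Or.inr (h.imp fun i hi => hs.adjoint_apply_of_apply hi)
    · push Not at h
      exact Or.inl (hs.adjoint_apply_of_forall_ne h)
  · rw [hs.adjoint_apply_iff] at h h'
    exact b.injective (h.symm.trans h')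

theorem comp_adjoint_comp (hs : IsPartialPerm b s) : s ∘L adjoint s ∘L s = s := by
  refine b.ext_continuousLinearMap fun i => ?_
  rw [comp_apply, comp_apply]
  rcases hs.1 i with hi | ⟨j, hj⟩
  · rw [hi, map_zero, map_zero]
  · rw [hj, hs.adjoint_apply_of_apply hj, hj]

theorem adjoint_comp_comp_adjoint (hs : IsPartialPerm b s) :
    adjoint s ∘L s ∘L adjoint s = adjoint s := by
  simpa only [adjoint_adjoint] using hs.adjoint.comp_adjoint_comp

theorem eq_adjoint (hs : IsPartialPerm b s) (ht : IsPartialPerm b t)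
    (h : s ∘L t ∘L s = s) (h' : t ∘L s ∘L t = t) : t = adjoint s := by
  refine ht.ext_iff hs.adjoint fun j i => ?_
  rw [hs.adjoint_apply_iff]
  exact ⟨ht.apply_of_comp_comp_eq hs h', hs.apply_of_comp_comp_eq ht h⟩

end IsPartialPerm

end PartialPermutation

section Relation

variable {ℓ : ℕ}

/-- The graph of the action of `B_{i+1}(r,m,n)` on the index set `ℕ^ℓ × ℤ`. -/
def BopRel (i : Fin (ℓ + 1)) (r : ℤ) (m n : Fin ℓ → ℕ) (p q : (Fin ℓ → ℕ) × ℤ) : Prop :=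
  (∀ j : Fin ℓ,
    ((j : ℕ) < i → p.1 j = n j ∧ q.1 j = m j) ∧
    ((j : ℕ) = i → n j ≤ p.1 j ∧ q.1 j + n j = p.1 j + m j) ∧
    ((i : ℕ) < j → q.1 j = p.1 j)) ∧
  q.2 - ∑ j, (q.1 j : ℤ) = p.2 - ∑ j, (p.1 j : ℤ) + if i = Fin.last ℓ then r else 0

theorem BopRel.symm {i : Fin (ℓ + 1)} {r : ℤ} {m n : Fin ℓ → ℕ} {p q : (Fin ℓ → ℕ) × ℤ}
    (h : BopRel i r m n p q) : BopRel i (-r) n m q p := by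
  refine ⟨fun j => ?_, ?_⟩
  · have := h.1 j
    omega
  · have := h.2
    split_ifs at this ⊢ <;> omega

theorem bopRel_symm_iff {i : Fin (ℓ + 1)} {r : ℤ} {m n : Fin ℓ → ℕ} {p q : (Fin ℓ → ℕ) × ℤ} :
    BopRel i r m n p q ↔ BopRel i (-r) n m q p :=
  ⟨BopRel.symm, fun h => by simpa using h.symm⟩

theorem BopRel.right_unique {i : Fin (ℓ + 1)} {r : ℤ} {m n : Fin ℓ → ℕ}
    {p q q' : (Fin ℓ → ℕ) × ℤ} (h : BopRel i r m n p q) (h' : BopRel i r m n p q') : q = q' := by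
  have h1 : q.1 = q'.1 := by
    funext j
    have := h.1 j
    have := h'.1 j
    omega
  refine Prod.ext h1 ?_
  have h2 := h.2
  have h2' := h'.2
  rw [h1] at h2
  omega

theorem BopRel.left_unique {i : Fin (ℓ + 1)} {r : ℤ} {m n : Fin ℓ → ℕ}
    {p p' q : (Fin ℓ → ℕ) × ℤ} (h : BopRel i r m n p q) (h' : BopRel i r m n p' q) : p = p' :=
  h.symm.right_unique h'.symm

/-- The relations `BopRel` are closed under composition, up to empty compositions; here the
relation applied second has the smaller index. -/
theorem exists_bopRel_comp_of_le {i i' : Fin (ℓ + 1)} (hi : i ≤ i') (r r' : ℤ)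
    (m n m' n' : Fin ℓ → ℕ) :
    (∀ p x q, BopRel i' r' m' n' p x → ¬ BopRel i r m n x q) ∨
    ∃ r'' m'' n'', ∀ p q,
      (∃ x, BopRel i' r' m' n' p x ∧ BopRel i r m n x q) ↔ BopRel i' r'' m'' n'' p q := by
  have hle : (i : ℕ) ≤ i' := hi
  by_cases hc : ∀ j : Fin ℓ, ((j : ℕ) < i → m' j = n j) ∧
      ((j : ℕ) = i → (i : ℕ) < i' → n j ≤ m' j)
  · right
    refine ⟨r' + (if i = Fin.last ℓ then r else 0),
      fun j => if (j : ℕ) < i then m j else if (j : ℕ) = i then m' j - n j + m j else m' j,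
      fun j => if (j : ℕ) = i then n' j + (n j - m' j) else n' j, fun p q => ⟨?_, fun h => ?_⟩⟩
    · rintro ⟨x, hx, hq⟩
      refine ⟨fun j => ?_, ?_⟩
      · have h1 := hx.1 j
        have h2 := hq.1 j
        have h3 := hc j
        dsimp only
        split_ifs <;> omega
      · have h1 := hx.2
        have h2 := hq.2
        have h3 : i = Fin.last ℓ → i' = Fin.last ℓ := fun h => Fin.last_le_iff.1 (h ▸ hi)
        split_ifs at h1 h2 ⊢ <;> omega
    · let x : Fin ℓ → ℕ := fun j =>
        if (j : ℕ) < i' then m' j else if (j : ℕ) = i' then p.1 j - n' j + m' j else p.1 j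
      refine ⟨(x, p.2 - ∑ j, (p.1 j : ℤ) + (if i' = Fin.last ℓ then r' else 0) +
        ∑ j, (x j : ℤ)), ⟨fun j => ?_, ?_⟩, fun j => ?_, ?_⟩
      · have h1 := h.1 j
        have h3 := hc j
        dsimp only [x] at h1 ⊢
        split_ifs at h1 ⊢ <;> omega
      · dsimp only
        ring
      · have h1 := h.1 j
        have h3 := hc j
        dsimp only [x] at h1 ⊢
        split_ifs at h1 ⊢ <;> omega
      · have h1 := h.2
        have h3 : i = Fin.last ℓ → i' = Fin.last ℓ := fun h => Fin.last_le_iff.1 (h ▸ hi)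
        dsimp only
        split_ifs at h1 ⊢ <;> omega
  · left
    intro p x q hx hq
    refine hc fun j => ?_
    have h1 := hx.1 j
    have h2 := hq.1 j
    omega

theorem exists_bopRel_comp (i i' : Fin (ℓ + 1)) (r r' : ℤ) (m n m' n' : Fin ℓ → ℕ) :
    (∀ p x q, BopRel i' r' m' n' p x → ¬ BopRel i r m n x q) ∨
    ∃ i'' r'' m'' n'', ∀ p q,
      (∃ x, BopRel i' r' m' n' p x ∧ BopRel i r m n x q) ↔ BopRel i'' r'' m'' n'' p q := by
  rcases le_total i i' with hi | hi
  · exact (exists_bopRel_comp_of_le hi r r' m n m' n').imp_right fun h => ⟨i', h⟩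
  · rcases exists_bopRel_comp_of_le hi (-r') (-r) n' m' n m with h | ⟨r'', m'', n'', h⟩
    · exact Or.inl fun p x q hx hq => h q x p hq.symm hx.symm
    · refine Or.inr ⟨i, -r'', n'', m'', fun p q => ?_⟩
      rw [← bopRel_symm_iff, ← h q p]
      refine exists_congr fun x => ?_
      rw [bopRel_symm_iff (r := r'), bopRel_symm_iff (r := r), and_comm]

end Relation

section Bop

open ContinuousLinearMap

variable {ℓ : ℕ}

/-- The standard Hilbert basis of `H`. -/
def stdBasis (ℓ : ℕ) : HilbertBasis ((Fin ℓ → ℕ) × ℤ) ℂ (H ℓ) :=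
  HilbertBasis.ofRepr (LinearIsometryEquiv.refl ℂ (H ℓ))

theorem stdBasis_apply (p : (Fin ℓ → ℕ) × ℤ) : stdBasis ℓ p = basisVec ℓ p.1 p.2 := by
  rw [← (stdBasis ℓ).repr_symm_single p]
  simp only [basisVec]
  rfl

variable {B : Fin (ℓ + 1) → ℤ → (Fin ℓ → ℕ) → (Fin ℓ → ℕ) → (H ℓ →L[ℂ] H ℓ)}

theorem IsBop.apply_castSucc (hB : IsBop ℓ B) (k : Fin ℓ) (r : ℤ) (m n : Fin ℓ → ℕ)
    (p : (Fin ℓ → ℕ) × ℤ) :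
    (∃ q, BopRel k.castSucc r m n p q ∧
      B k.castSucc r m n (stdBasis ℓ p) = stdBasis ℓ q) ∨
    (∀ q, ¬ BopRel k.castSucc r m n p q) ∧ B k.castSucc r m n (stdBasis ℓ p) = 0 := by
  rw [stdBasis_apply, hB.1]
  split_ifs with h
  · set a : Fin ℓ → ℕ :=
      fun j => if j < k then m j else if j = k then p.1 k - n k + m k else p.1 j with ha
    have hlt : ∀ j < k, p.1 j = n j ∧ a j = m j := fun j hj => ⟨h.1 j hj, by simp [ha, hj]⟩
    have heq : n k ≤ p.1 k ∧ a k + n k = p.1 k + m k := by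
      have hk : a k = p.1 k - n k + m k := by simp [ha]
      have := h.2
      omega
    have hgt : ∀ j, k < j → a j = p.1 j := fun j hj => by
      simp [ha, hj.not_gt, hj.ne']
    refine Or.inl ⟨(a, _), ⟨fun j => ⟨hlt j, fun hj => ?_, hgt j⟩, ?_⟩,
      (stdBasis_apply (_, _)).symm⟩
    · obtain rfl := Fin.ext hj
      exact heq
    · rw [if_neg (Fin.castSucc_lt_last k).ne]
      dsimp only
      rw [Finset.sum_filter, add_zero, add_sub_assoc, sub_eq_add_neg p.2, add_right_inj,
        ← Finset.sum_sub_distrib, ← Finset.sum_neg_distrib]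
      refine Finset.sum_congr rfl fun j _ => ?_
      rcases lt_trichotomy j k with hj | rfl | hj
      · have := hlt j hj
        rw [if_pos hj.le]
        omega
      · rw [if_pos le_rfl]
        omega
      · rw [if_neg hj.not_ge, hgt j hj, zero_sub]
  · refine Or.inr ⟨fun q hq => h ⟨fun j hj => ?_, ?_⟩, rfl⟩
    · exact ((hq.1 j).1 hj).1
    · exact ((hq.1 k).2.1 rfl).1

theorem IsBop.apply_last (hB : IsBop ℓ B) (r : ℤ) (m n : Fin ℓ → ℕ) (p : (Fin ℓ → ℕ) × ℤ) :
    (∃ q, BopRel (Fin.last ℓ) r m n p q ∧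
      B (Fin.last ℓ) r m n (stdBasis ℓ p) = stdBasis ℓ q) ∨
    (∀ q, ¬ BopRel (Fin.last ℓ) r m n p q) ∧ B (Fin.last ℓ) r m n (stdBasis ℓ p) = 0 := by
  rw [stdBasis_apply, hB.2]
  split_ifs with h
  · refine Or.inl ⟨(_, _), ⟨fun j => ?_, ?_⟩, (stdBasis_apply (_, _)).symm⟩
    · have hj := j.isLt
      simp only [Fin.val_last, h, and_self, implies_true, true_and]
      omega
    · rw [if_pos rfl, h, Finset.sum_sub_distrib]
      ring
  · exact Or.inr ⟨fun q hq => h (funext fun j => ((hq.1 j).1 j.isLt).1), rfl⟩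

theorem IsBop.apply_cases (hB : IsBop ℓ B) (i : Fin (ℓ + 1)) (r : ℤ) (m n : Fin ℓ → ℕ)
    (p : (Fin ℓ → ℕ) × ℤ) :
    (∃ q, BopRel i r m n p q ∧ B i r m n (stdBasis ℓ p) = stdBasis ℓ q) ∨
    (∀ q, ¬ BopRel i r m n p q) ∧ B i r m n (stdBasis ℓ p) = 0 := by
  induction i using Fin.lastCases with
  | last => exact hB.apply_last r m n p
  | cast k => exact hB.apply_castSucc k r m n p

theorem IsBop.apply_iff (hB : IsBop ℓ B) {i : Fin (ℓ + 1)} {r : ℤ} {m n : Fin ℓ → ℕ}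
    {p q : (Fin ℓ → ℕ) × ℤ} :
    B i r m n (stdBasis ℓ p) = stdBasis ℓ q ↔ BopRel i r m n p q := by
  rcases hB.apply_cases i r m n p with ⟨q', hq', h⟩ | ⟨hn, h⟩
  · rw [h, (stdBasis ℓ).injective.eq_iff]
    exact ⟨fun e => e ▸ hq', hq'.right_unique⟩
  · rw [h]
    exact ⟨fun e => ((stdBasis ℓ).apply_ne_zero q e.symm).elim, fun e => (hn q e).elim⟩

theorem IsBop.isPartialPerm (hB : IsBop ℓ B) (i : Fin (ℓ + 1)) (r : ℤ) (m n : Fin ℓ → ℕ) :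
    IsPartialPerm (stdBasis ℓ) (B i r m n) := by
  refine ⟨fun p => ?_, fun p p' q h h' => (hB.apply_iff.1 h).left_unique (hB.apply_iff.1 h')⟩
  rcases hB.apply_cases i r m n p with ⟨q, -, h⟩ | ⟨-, h⟩
  · exact Or.inr ⟨q, h⟩
  · exact Or.inl h

theorem IsBop.isPartialPerm_of_mem (hB : IsBop ℓ B) {s : H ℓ →L[ℂ] H ℓ} (hs : s ∈ Tset ℓ B) :
    IsPartialPerm (stdBasis ℓ) s := by
  rcases hs with rfl | ⟨i, r, m, n, rfl⟩
  · exact .zero _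
  · exact hB.isPartialPerm i r m n

theorem IsBop.adjoint_eq (hB : IsBop ℓ B) (i : Fin (ℓ + 1)) (r : ℤ) (m n : Fin ℓ → ℕ) :
    adjoint (B i r m n) = B i (-r) n m := by
  refine (hB.isPartialPerm i r m n).adjoint.ext_iff (hB.isPartialPerm i (-r) n m) fun p q => ?_
  rw [(hB.isPartialPerm i r m n).adjoint_apply_iff, hB.apply_iff, hB.apply_iff, bopRel_symm_iff]

theorem IsBop.adjoint_mem (hB : IsBop ℓ B) {s : H ℓ →L[ℂ] H ℓ} (hs : s ∈ Tset ℓ B) :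
    adjoint s ∈ Tset ℓ B := by
  rcases hs with rfl | ⟨i, r, m, n, rfl⟩
  · exact Or.inl (map_zero _)
  · exact Or.inr ⟨i, -r, n, m, hB.adjoint_eq i r m n⟩

theorem IsBop.comp_mem (hB : IsBop ℓ B) {s t : H ℓ →L[ℂ] H ℓ} (hs : s ∈ Tset ℓ B)
    (ht : t ∈ Tset ℓ B) : s ∘L t ∈ Tset ℓ B := by
  rcases hs with rfl | ⟨i, r, m, n, rfl⟩
  · exact Or.inl (zero_comp t)
  rcases ht with rfl | ⟨i', r', m', n', rfl⟩
  · exact Or.inl (comp_zero _)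
  have ht := hB.isPartialPerm i' r' m' n'
  have hst := (hB.isPartialPerm i r m n).comp ht
  rcases exists_bopRel_comp i i' r r' m n m' n' with h | ⟨i'', r'', m'', n'', h⟩
  · refine Or.inl (hst.eq_zero fun p q hpq => ?_)
    obtain ⟨x, hx, hq⟩ := ht.comp_apply_iff.1 hpq
    exact h p x q (hB.apply_iff.1 hx) (hB.apply_iff.1 hq)
  · refine Or.inr ⟨i'', r'', m'', n'', hst.ext_iff (hB.isPartialPerm _ _ _ _) fun p q => ?_⟩
    rw [ht.comp_apply_iff, hB.apply_iff, ← h p q]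
    simp only [hB.apply_iff]

end Bop

open ContinuousLinearMap in
/-- `T` is an inverse semigroup of partial isometries: it is closed under operator
multiplication and adjoints, and for every `s ∈ T`, `s*` is the unique `t ∈ T` with
`s t s = s` and `t s t = t`. -/
theorem Tset_inverseSemigroup (ℓ : ℕ) (hℓ : 1 ≤ ℓ)
    (B : Fin (ℓ + 1) → ℤ → (Fin ℓ → ℕ) → (Fin ℓ → ℕ) → (H ℓ →L[ℂ] H ℓ))
    (hB : IsBop ℓ B) :
    (∀ s ∈ Tset ℓ B, ∀ t ∈ Tset ℓ B, s ∘L t ∈ Tset ℓ B) ∧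
    (∀ s ∈ Tset ℓ B, adjoint s ∈ Tset ℓ B) ∧
    (∀ s ∈ Tset ℓ B,
      (s ∘L adjoint s ∘L s = s ∧ adjoint s ∘L s ∘L adjoint s = adjoint s) ∧
      (∀ t ∈ Tset ℓ B, s ∘L t ∘L s = s → t ∘L s ∘L t = t → t = adjoint s)) := by
  refine ⟨fun s hs t ht => hB.comp_mem hs ht, fun s hs => hB.adjoint_mem hs, fun s hs => ?_⟩
  have hs := hB.isPartialPerm_of_mem hs
  exact ⟨⟨hs.comp_adjoint_comp, hs.adjoint_comp_comp_adjoint⟩,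
    fun t ht h h' => hs.eq_adjoint (hB.isPartialPerm_of_mem ht) h h'⟩
end
end

section
/- The map φ : \bar{ℕ}^ℓ → {0,1}^E, k ↦ φ(k), is continuous, where \bar{ℕ}^ℓ carries the product topology coming from the one-point compactification \bar{ℕ} of ℕ and {0,1}^E carries the product topology. -/
open scoped BigOperators

noncomputable section

/-- The set of projections `E = {0} ∪ {p_i(m)}`, where `p_i(m) = B_i(0,m,m)`. -/
def Eset (ℓ : ℕ)
    (B : Fin (ℓ + 1) → ℤ → (Fin ℓ → ℕ) → (Fin ℓ → ℕ) → (H ℓ →L[ℂ] H ℓ)) :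
    Set (H ℓ →L[ℂ] H ℓ) :=
  {0} ∪ {x | ∃ (i : Fin (ℓ + 1)) (m : Fin ℓ → ℕ), x = B i 0 m m}

/-- A filter in `E`: a nonempty subset `A ⊆ E` with `0 ∉ A`, closed under (operator)
multiplication, and upward closed in `E` for the usual (Loewner) order on operators. -/
def IsFilterIn (ℓ : ℕ)
    (B : Fin (ℓ + 1) → ℤ → (Fin ℓ → ℕ) → (Fin ℓ → ℕ) → (H ℓ →L[ℂ] H ℓ))
    (A : Set (H ℓ →L[ℂ] H ℓ)) : Prop :=
  A.Nonempty ∧ A ⊆ Eset ℓ B ∧ (0 : H ℓ →L[ℂ] H ℓ) ∉ A ∧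
    (∀ e ∈ A, ∀ f ∈ A, e * f ∈ A) ∧
    (∀ e ∈ A, ∀ f ∈ Eset ℓ B, e ≤ f → f ∈ A)

/-- An ultrafilter in `E`: a filter maximal under inclusion. -/
def IsUltrafilterIn (ℓ : ℕ)
    (B : Fin (ℓ + 1) → ℤ → (Fin ℓ → ℕ) → (Fin ℓ → ℕ) → (H ℓ →L[ℂ] H ℓ))
    (A : Set (H ℓ →L[ℂ] H ℓ)) : Prop :=
  IsFilterIn ℓ B A ∧ ∀ A' : Set (H ℓ →L[ℂ] H ℓ), IsFilterIn ℓ B A' → A ⊆ A' → A' = A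

/-- A character of `E`: a nonzero multiplicative map `E → {0,1}` (valued in `Bool`,
with `&&` as multiplication) vanishing at `0`. -/
def IsCharacter (ℓ : ℕ)
    (B : Fin (ℓ + 1) → ℤ → (Fin ℓ → ℕ) → (Fin ℓ → ℕ) → (H ℓ →L[ℂ] H ℓ))
    (x : {e : H ℓ →L[ℂ] H ℓ // e ∈ Eset ℓ B} → Bool) : Prop :=
  (∃ e, x e = true) ∧
    (∀ (e f : {e : H ℓ →L[ℂ] H ℓ // e ∈ Eset ℓ B}) (h : e.val * f.val ∈ Eset ℓ B),
      x ⟨e.val * f.val, h⟩ = (x e && x f)) ∧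
    (∀ h : (0 : H ℓ →L[ℂ] H ℓ) ∈ Eset ℓ B, x ⟨0, h⟩ = false)

/-- `LeastInf ℓ k r` says that `r` is the least nonnegative integer such that
`k_{r+1} = ∞` (paper indexing, with the convention `k_{ℓ+1} = ∞`).  In the 0-indexed
formulation: `r ≤ ℓ`, `k r = ∞` if `r < ℓ`, and `k j ≠ ∞` for all `j < r`. -/
def LeastInf (ℓ : ℕ) (k : Fin ℓ → ℕ∞) (r : ℕ) : Prop :=
  r ≤ ℓ ∧ (∀ h : r < ℓ, k ⟨r, h⟩ = ⊤) ∧ ∀ j : Fin ℓ, (j : ℕ) < r → k j ≠ ⊤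

/-- The support of the character `φ(k)`, `k ∈ ℕ̄^ℓ`: it contains `p_i(m)` (paper index
`i ≤ ℓ`) iff `π_{i−1}(m) = π_{i−1}(k)` and `m_i ≤ k_i`, and `p_{ℓ+1}(m)` iff `m = k`. -/
def phiSupp (ℓ : ℕ)
    (B : Fin (ℓ + 1) → ℤ → (Fin ℓ → ℕ) → (Fin ℓ → ℕ) → (H ℓ →L[ℂ] H ℓ))
    (k : Fin ℓ → ℕ∞) : Set (H ℓ →L[ℂ] H ℓ) :=
  {x | (∃ (i : Fin ℓ) (m : Fin ℓ → ℕ), x = B i.castSucc 0 m m ∧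
          (∀ j : Fin ℓ, j < i → (m j : ℕ∞) = k j) ∧ (m i : ℕ∞) ≤ k i) ∨
       (∃ m : Fin ℓ → ℕ, x = B (Fin.last ℓ) 0 m m ∧ ∀ j : Fin ℓ, (m j : ℕ∞) = k j)}

open Classical in
/-- The character `φ(k) : E → {0,1}` associated to `k ∈ ℕ̄^ℓ`. -/
noncomputable def phi (ℓ : ℕ)
    (B : Fin (ℓ + 1) → ℤ → (Fin ℓ → ℕ) → (Fin ℓ → ℕ) → (H ℓ →L[ℂ] H ℓ))
    (k : Fin ℓ → ℕ∞) : {e : H ℓ →L[ℂ] H ℓ // e ∈ Eset ℓ B} → Bool :=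
  fun e => decide (e.val ∈ phiSupp ℓ B k)

/-- The set of `k ∈ ℕ̄^ℓ` which agree with `m` in all coordinates before `i` and are at least
`m i` in coordinate `i`; for `i = Fin.last ℓ` this is the singleton `{m}`. -/
def prefixSet {ℓ : ℕ} (i : Fin (ℓ + 1)) (m : Fin ℓ → ℕ) : Set (Fin ℓ → ℕ∞) :=
  {k | (∀ j : Fin ℓ, j.castSucc < i → (m j : ℕ∞) = k j) ∧
    ∀ j : Fin ℓ, j.castSucc = i → (m j : ℕ∞) ≤ k j}

theorem mem_prefixSet_castSucc {ℓ : ℕ} {i : Fin ℓ} {m : Fin ℓ → ℕ} {k : Fin ℓ → ℕ∞} :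
    k ∈ prefixSet i.castSucc m ↔ (∀ j : Fin ℓ, j < i → (m j : ℕ∞) = k j) ∧ (m i : ℕ∞) ≤ k i := by
  simp [prefixSet]

theorem mem_prefixSet_last {ℓ : ℕ} {m : Fin ℓ → ℕ} {k : Fin ℓ → ℕ∞} :
    k ∈ prefixSet (Fin.last ℓ) m ↔ ∀ j : Fin ℓ, (m j : ℕ∞) = k j := by
  simp [prefixSet, Fin.castSucc_lt_last, Fin.castSucc_ne_last]

theorem ENat.isClopen_singleton_natCast (n : ℕ) : IsClopen ({(n : ℕ∞)} : Set ℕ∞) :=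
  ⟨isClosed_singleton, ENat.isOpen_singleton (ENat.natCast_ne_top n)⟩

theorem ENat.isClopen_Ici_natCast (n : ℕ) : IsClopen (Set.Ici (n : ℕ∞)) := by
  refine ⟨isClosed_Ici, ?_⟩
  cases n with
  | zero => simp
  | succ n =>
    have h : Set.Ici ((n + 1 : ℕ) : ℕ∞) = Set.Ioi (n : ℕ∞) := by
      ext x
      simp [ENat.add_one_le_iff (ENat.natCast_ne_top n)]
    exact h ▸ isOpen_Ioi

theorem ENat.denseRange_natCast : DenseRange ((↑) : ℕ → ℕ∞) := by
  intro x
  induction x using ENat.recTopCoe with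
  | top =>
    exact mem_closure_of_tendsto ENat.tendsto_natCast_nhds_top
      (Filter.Eventually.of_forall Set.mem_range_self)
  | coe n => exact subset_closure (Set.mem_range_self n)

theorem isClopen_prefixSet {ℓ : ℕ} (i : Fin (ℓ + 1)) (m : Fin ℓ → ℕ) :
    IsClopen (prefixSet i m) := by
  have h : prefixSet i m =
      (⋂ j : Fin ℓ, ⋂ _ : j.castSucc < i, Function.eval j ⁻¹' {(m j : ℕ∞)}) ∩
        ⋂ j : Fin ℓ, ⋂ _ : j.castSucc = i, Function.eval j ⁻¹' Set.Ici (m j : ℕ∞) := by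
    ext k
    simp [prefixSet, eq_comm]
  rw [h]
  exact (isClopen_iInter_of_finite fun j => isClopen_iInter_of_finite fun _ =>
      (ENat.isClopen_singleton_natCast (m j)).preimage (continuous_apply j)).inter
    (isClopen_iInter_of_finite fun j => isClopen_iInter_of_finite fun _ =>
      (ENat.isClopen_Ici_natCast (m j)).preimage (continuous_apply j))

theorem basisVec_ne_zero (ℓ : ℕ) (a : Fin ℓ → ℕ) (z : ℤ) : basisVec ℓ a z ≠ 0 := by
  intro h
  have h1 : basisVec ℓ a z (a, z) = 1 := lp.single_apply_self _ _ _
  simp [h] at h1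

theorem mem_phiSupp_iff {ℓ : ℕ}
    {B : Fin (ℓ + 1) → ℤ → (Fin ℓ → ℕ) → (Fin ℓ → ℕ) → (H ℓ →L[ℂ] H ℓ)}
    {k : Fin ℓ → ℕ∞} {x : H ℓ →L[ℂ] H ℓ} :
    x ∈ phiSupp ℓ B k ↔ ∃ i m, x = B i 0 m m ∧ k ∈ prefixSet i m := by
  simp only [phiSupp, Set.mem_ofPred_eq, Fin.exists_fin_succ', mem_prefixSet_castSucc,
    mem_prefixSet_last]

open Classical in
theorem IsBop.apply_basisVec {ℓ : ℕ}
    {B : Fin (ℓ + 1) → ℤ → (Fin ℓ → ℕ) → (Fin ℓ → ℕ) → (H ℓ →L[ℂ] H ℓ)}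
    (hB : IsBop ℓ B) (i : Fin (ℓ + 1)) (m a : Fin ℓ → ℕ) (z : ℤ) :
    B i 0 m m (basisVec ℓ a z) =
      if (fun j => (a j : ℕ∞)) ∈ prefixSet i m then basisVec ℓ a z else 0 := by
  induction i using Fin.lastCases with
  | last =>
    rw [hB.2]
    by_cases h : a = m
    · simp [mem_prefixSet_last, h]
    · have h' : ¬ ∀ j, m j = a j := fun h' => h (funext fun j => (h' j).symm)
      simp [mem_prefixSet_last, h, h']
  | cast i =>
    rw [hB.1]
    simp only [mem_prefixSet_castSucc, Nat.cast_inj, Nat.cast_le, sub_self, Finset.sum_const_zero,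
      add_zero]
    by_cases h : (∀ j : Fin ℓ, j < i → a j = m j) ∧ m i ≤ a i
    · rw [if_pos h, if_pos ⟨fun j hj => (h.1 j hj).symm, h.2⟩]
      congr 1
      ext j
      split_ifs with h1 h2
      · exact (h.1 j h1).symm
      · rw [h2, Nat.sub_add_cancel h.2]
      · rfl
    · rw [if_neg h, if_neg fun h' => h ⟨fun j hj => (h'.1 j hj).symm, h'.2⟩]

/-- The projection `p_i(m)` determines the set of `k` with `φ(k)(p_i(m)) = 1`. -/
theorem IsBop.prefixSet_eq {ℓ : ℕ}
    {B : Fin (ℓ + 1) → ℤ → (Fin ℓ → ℕ) → (Fin ℓ → ℕ) → (H ℓ →L[ℂ] H ℓ)}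
    (hB : IsBop ℓ B) {i i' : Fin (ℓ + 1)} {m m' : Fin ℓ → ℕ} (h : B i 0 m m = B i' 0 m' m') :
    prefixSet i m = prefixSet i' m' := by
  classical
  have hind : (prefixSet i m).boolIndicator = (prefixSet i' m').boolIndicator := by
    refine (DenseRange.piMap fun _ : Fin ℓ => ENat.denseRange_natCast).equalizer
      ((continuous_boolIndicator_iff_isClopen _).2 (isClopen_prefixSet i m))
      ((continuous_boolIndicator_iff_isClopen _).2 (isClopen_prefixSet i' m')) ?_
    ext1 a
    have key := congrArg (fun T => T (basisVec ℓ a 0)) h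
    simp only [hB.apply_basisVec] at key
    have hiff : (fun j => (a j : ℕ∞)) ∈ prefixSet i m ↔
        (fun j => (a j : ℕ∞)) ∈ prefixSet i' m' := by
      split_ifs at key <;> simp_all [basisVec_ne_zero, eq_comm]
    simp only [Set.boolIndicator, Function.comp_apply]
    exact if_congr hiff rfl rfl
  ext k
  rw [Set.mem_iff_boolIndicator, hind, ← Set.mem_iff_boolIndicator]

theorem IsBop.isClopen_setOf_mem_phiSupp {ℓ : ℕ}
    {B : Fin (ℓ + 1) → ℤ → (Fin ℓ → ℕ) → (Fin ℓ → ℕ) → (H ℓ →L[ℂ] H ℓ)}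
    (hB : IsBop ℓ B) (x : H ℓ →L[ℂ] H ℓ) : IsClopen {k | x ∈ phiSupp ℓ B k} := by
  simp only [mem_phiSupp_iff]
  by_cases hx : ∃ i m, x = B i 0 m m
  · obtain ⟨i, m, rfl⟩ := hx
    convert isClopen_prefixSet i m using 1
    ext k
    refine ⟨?_, fun hk => ⟨i, m, rfl, hk⟩⟩
    rintro ⟨i', m', h, hk⟩
    rwa [hB.prefixSet_eq h]
  · convert isClopen_empty using 1
    exact Set.eq_empty_of_forall_notMem fun k ⟨i, m, h, _⟩ => hx ⟨i, m, h⟩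

/-- The map `φ : ℕ̄^ℓ → {0,1}^E` is continuous, where `ℕ̄ = ℕ∞` carries the
topology of the one-point compactification of `ℕ` (the order topology on `ℕ∞`),
`ℕ̄^ℓ` the product topology, and `{0,1}^E` the product topology with `{0,1} = Bool`
discrete. -/
theorem phi_continuous (ℓ : ℕ) (hℓ : 1 ≤ ℓ)
    (B : Fin (ℓ + 1) → ℤ → (Fin ℓ → ℕ) → (Fin ℓ → ℕ) → (H ℓ →L[ℂ] H ℓ))
    (hB : IsBop ℓ B) :
    Continuous (phi ℓ B) := by
  refine continuous_pi fun e => (continuous_bool_rng true).2 ?_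
  convert hB.isClopen_setOf_mem_phiSupp e.val using 1
  ext k
  simp [phi]
end
end
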